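/- Let K be a field and R = MvPolynomial (Fin 3 × Fin 3) K, the polynomial ring in the entries x_{ij} = X (i, j) of a generic 3×3 matrix X, and let Δ = det X ∈ R. Let (i₁, i₂, i₃) and (j₁, j₂, j₃) each be an enumeration of the three elements of Fin 3 (given by permutations of Fin 3), and let μ = x_{i₁j₁} x_{i₂j₂} − x_{i₁j₂} x_{i₂j₁}. Then the ideal J = Ideal.span {Δ, μ, x_{i₃j₂}} of R has height 3. -/

import Mathlib

open MvPolynomial

/-- The height of an ideal `I`: the infimum of the heights of the prime ideals
containing `I` (the height of a prime being its height in the prime spectrum). -/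
noncomputable def idealHeight {R : Type*} [CommRing R] (I : Ideal R) : ℕ∞ :=
  ⨅ p ∈ {p : PrimeSpectrum R | I ≤ p.asIdeal}, Order.height p

/-- A binomial `x_a x_d - x_b x_c` in four distinct variables is a prime element. -/
lemma prime_X_mul_X_sub_X_mul_X {n K : Type*} [Field K] {a b c d : n}
    (hab : a ≠ b) (hac : a ≠ c) (had : a ≠ d) (hbd : b ≠ d) (hcd : c ≠ d) :
    Prime (X a * X d - X b * X c : MvPolynomial n K) := by
  classical
  rw [← irreducible_iff_prime, sub_eq_add_neg]
  refine irreducible_mul_X_add _ _ d (X_ne_zero a) ?_ ?_ ?_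
  · simpa using had.symm
  · intro h
    rw [vars_neg] at h
    have := vars_mul _ _ h
    simp [hbd.symm, hcd.symm] at this
  · rw [(X_prime (i := a)).irreducible.isRelPrime_iff_not_dvd, dvd_neg, (X_prime (i := a)).dvd_mul]
    simp [X_dvd_X, hab, hac]

/-- There is an invertible matrix at which a given `2 × 2` minor and a given entry, lying in one
of its columns but outside its rows, both vanish. -/
lemma exists_eval_det_ne_zero (K : Type*) [Field K] (σ τ : Equiv.Perm (Fin 3)) :
    ∃ v : Fin 3 × Fin 3 → K,
      eval v (Matrix.of fun i j : Fin 3 => (X (i, j) : MvPolynomial (Fin 3 × Fin 3) K)).det ≠ 0 ∧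
      eval v (X (σ 0, τ 0) * X (σ 1, τ 1) - X (σ 0, τ 1) * X (σ 1, τ 0)) = 0 ∧
      v (σ 2, τ 1) = 0 := by
  let ρ : Equiv.Perm (Fin 3) := (σ.symm.trans (finRotate 3)).trans τ
  refine ⟨fun x => ρ.permMatrix K x.1 x.2, ?_, ?_, ?_⟩
  · have h : (eval fun x : Fin 3 × Fin 3 => ρ.permMatrix K x.1 x.2).mapMatrix
        (Matrix.of fun i j : Fin 3 => X (i, j)) = ρ.permMatrix K := by
      ext i j
      simp
    rw [RingHom.map_det, h, Matrix.det_permutation]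
    rcases Int.units_eq_one_or (Equiv.Perm.sign ρ) with h | h <;> simp [h]
  · simp [ρ, PEquiv.toMatrix_apply]
  · simp [ρ, PEquiv.toMatrix_apply]

/-- Killing one variable `x_h`: a prime ideal containing `x_h`, a prime element `f` not involving
`x_h`, and an element `g` that does not vanish at some common zero of `x_h` and `f`, has height
at least three. -/
lemma three_le_height_of_mem {n K : Type*} [Field K] {P : Ideal (MvPolynomial n K)} [P.IsPrime]
    {h : n} {f g : MvPolynomial n K} (hf : Prime f) (hfh : h ∉ f.vars) {v : n → K}
    (hvh : v h = 0) (hvf : eval v f = 0) (hvg : eval v g ≠ 0)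
    (hP : X h ∈ P) (hfP : f ∈ P) (hgP : g ∈ P) : 3 ≤ P.height := by
  classical
  let φ : MvPolynomial n K →ₐ[K] MvPolynomial n K := aeval (Function.update X h 0)
  have hφf : φ f = f := by
    conv_rhs => rw [← aeval_X_left_apply f]
    refine eval₂Hom_congr' rfl (fun i hi _ => ?_) rfl
    exact Function.update_of_ne (by rintro rfl; exact hfh hi) _ _
  have hφP (p) : p - φ p ∈ P := by
    rw [← Ideal.Quotient.eq]
    have : (Ideal.Quotient.mkₐ K P).comp φ = Ideal.Quotient.mkₐ K P := by
      ext i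
      by_cases hi : i = h
      · subst hi
        simpa [φ] using (Ideal.Quotient.eq_zero_iff_mem.mpr hP).symm
      · simp [φ, hi]
    exact (DFunLike.congr_fun this p).symm
  have hφv (p) : eval v (φ p) = eval v p := by
    have : (aeval v).comp φ = aeval v := by
      ext i
      by_cases hi : i = h
      · subst hi
        simp [φ, hvh]
      · simp [φ, hi]
    simpa [aeval_eq_eval] using DFunLike.congr_fun this p
  have : (Ideal.span {f}).IsPrime := (Ideal.span_singleton_prime hf.ne_zero).mpr hf
  let N := (⊥ : Ideal (MvPolynomial n K)).comap φ
  let Q := (Ideal.span {f}).comap φ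
  have : N.IsPrime := Ideal.comap_isPrime φ ⊥
  have : Q.IsPrime := Ideal.comap_isPrime φ _
  have hN : ⊥ < N := by
    refine bot_lt_iff_ne_bot.mpr (Submodule.ne_bot_iff _ |>.mpr ⟨X h, ?_, X_ne_zero h⟩)
    simp [N, φ]
  have hNQ : N < Q := by
    refine lt_of_le_not_ge (Ideal.comap_mono bot_le) fun H => hf.ne_zero ?_
    have : f ∈ N := H (by simp [Q, hφf])
    simpa [N, hφf] using this
  have hQP : Q < P := by
    refine lt_of_le_not_ge (fun p hp => ?_) fun H => hvg ?_
    · have : φ p ∈ P := (Ideal.span_singleton_le_iff_mem _).mpr hfP hp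
      simpa using add_mem (hφP p) this
    · obtain ⟨q, hq⟩ := Ideal.mem_span_singleton.mp (show φ g ∈ Ideal.span {f} from H hgP)
      rw [← hφv, hq, map_mul, hvf, zero_mul]
  calc (3 : ℕ∞) = 0 + 1 + 1 + 1 := by norm_num
    _ ≤ (⊥ : Ideal (MvPolynomial n K)).height + 1 + 1 + 1 := by gcongr; exact zero_le
    _ ≤ N.height + 1 + 1 := by gcongr; exact Ideal.height_add_one_le_of_lt_of_isPrime hN
    _ ≤ Q.height + 1 := by gcongr; exact Ideal.height_add_one_le_of_lt_of_isPrime hNQ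
    _ ≤ P.height := Ideal.height_add_one_le_of_lt_of_isPrime hQP

/-- The height computation from the proof of Proposition 3.8: the ideal
`J = (det X, μ, x_{i₃ j₂})` has height 3. Enumerations of rows and columns are
given by permutations `σ, τ` of `Fin 3`, with `iₖ = σ (k-1)`, `jₖ = τ (k-1)`. -/
theorem stmt_14 (K : Type*) [Field K] (σ τ : Equiv.Perm (Fin 3)) :
    idealHeight (Ideal.span
      {(Matrix.of fun i j : Fin 3 =>
          (X (i, j) : MvPolynomial (Fin 3 × Fin 3) K)).det,
       X (σ 0, τ 0) * X (σ 1, τ 1) - X (σ 0, τ 1) * X (σ 1, τ 0),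
       X (σ 2, τ 1)}) = 3 := by
  obtain ⟨v, hvg, hvf, hvh⟩ := exists_eval_det_ne_zero K σ τ
  apply le_antisymm
  · set s : Set (MvPolynomial (Fin 3 × Fin 3) K) := {_, _, _} with hs
    have hne : Ideal.span s ≠ ⊤ := by
      refine ne_top_of_le_ne_top (RingHom.ker_ne_top (constantCoeff (R := K))) ?_
      rw [Ideal.span_le]
      rintro p (rfl | rfl | rfl) <;> simp [RingHom.mem_ker, Matrix.det_fin_three]
    obtain ⟨p, hp⟩ := Ideal.nonempty_minimalPrimes hne
    have hcard : s.ncard ≤ 3 := Set.ncard_insert_le _ _ |>.trans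
      (Nat.succ_le_succ ((Set.ncard_insert_le _ _).trans (by simp)))
    calc idealHeight (Ideal.span s)
        ≤ Order.height (⟨p, hp.isPrime⟩ : PrimeSpectrum _) := iInf₂_le (⟨p, hp.isPrime⟩ : PrimeSpectrum _) hp.le
      _ = p.height := (PrimeSpectrum.height_eq_orderHeight _).symm
      _ ≤ s.ncard := Ideal.height_le_card_of_mem_minimalPrimes_span (by simp [hs]) hp
      _ ≤ 3 := by exact_mod_cast hcard
  · refine le_iInf₂ fun p hp => ?_
    have hp' := Ideal.span_le.mp hp
    rw [← PrimeSpectrum.height_eq_orderHeight]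
    refine three_le_height_of_mem (prime_X_mul_X_sub_X_mul_X ?_ ?_ ?_ ?_ ?_) ?_ hvh hvf hvg
      (hp' (by simp)) (hp' (by simp)) (hp' (by simp))
    any_goals simp
    intro h
    have := vars_sub_subset _ h
    rw [Finset.mem_union] at this
    rcases this with h | h <;> simpa using vars_mul _ _ h
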